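/- arXiv:2211.16401 — 13 statements merged into one kernel-verified Lean document; each statement's English description precedes it below -/
import Mathlib

section
/- With the eight transfer matrices M, N, M̃, Ñ, X, Y, X̃, Ỹ defined over K = RatFunc ℝ from the state-space data (A,B,C) and the gains F, L as above, the Bézout identities hold: Matrix.fromBlocks M̃ Ñ (−X) Y * Matrix.fromBlocks Ỹ (−N) X̃ M = 1 and Matrix.fromBlocks Ỹ (−N) X̃ M * Matrix.fromBlocks M̃ Ñ (−X) Y = 1, where 1 is the identity matrix of size p+m. -/
open Matrix

set_option synthInstance.maxHeartbeats 400000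

noncomputable section

/-- The characteristic matrix of a square matrix is invertible over the field of
rational functions. -/
theorem isUnit_ratFunc_X_smul_one_sub_map {k ι : Type*} [Field k] [Fintype ι] [DecidableEq ι]
    (A : Matrix ι ι k) :
    IsUnit ((RatFunc.X : RatFunc k) • (1 : Matrix ι ι (RatFunc k)) -
      A.map (algebraMap k (RatFunc k))) := by
  have h : (RatFunc.X : RatFunc k) • (1 : Matrix ι ι (RatFunc k)) -
      A.map (algebraMap k (RatFunc k)) =
      (algebraMap (Polynomial k) (RatFunc k)).mapMatrix A.charmatrix := by
    ext i j
    by_cases hij : i = j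
    · subst hij
      simp [RatFunc.algebraMap_eq_C]
    · simp [hij, RatFunc.algebraMap_eq_C]
  rw [Matrix.isUnit_iff_isUnit_det, h, ← RingHom.map_det, isUnit_iff_ne_zero]
  exact RatFunc.algebraMap_ne_zero A.charpoly_monic.ne_zero

/-- The resolvent identity, multiplied by `P` on the left and by `Q` on the right. -/
theorem mul_mul_eq_of_resolvent {K ι μ π α β : Type*} [CommRing K]
    [Fintype ι] [Fintype μ] [Fintype π]
    (B : Matrix ι μ K) (C : Matrix π ι K) (F : Matrix μ ι K) (L : Matrix ι π K)
    (R S : Matrix ι ι K) (h : R - S = S * (B * F + L * C) * R)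
    (P : Matrix α ι K) (Q : Matrix ι β K) :
    P * R * Q = P * S * Q + P * S * B * (F * R * Q) + P * S * L * (C * R * Q) := by
  rw [sub_eq_iff_eq_add'] at h
  conv_lhs => rw [h]
  simp only [Matrix.mul_add, Matrix.add_mul, Matrix.mul_assoc, add_assoc]

/-- The Bézout identity for block matrices built from two resolvents `R` and `S` that satisfy the
resolvent identity. -/
theorem fromBlocks_mul_fromBlocks_eq_one_of_resolvent {K ι μ π : Type*} [CommRing K]
    [Fintype ι] [Fintype μ] [DecidableEq μ] [Fintype π] [DecidableEq π]
    (B : Matrix ι μ K) (C : Matrix π ι K) (F : Matrix μ ι K) (L : Matrix ι π K)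
    (R S : Matrix ι ι K) (h : R - S = S * (B * F + L * C) * R) :
    fromBlocks (1 - C * S * L) (C * S * B) (-(-(F * S * L))) (1 - F * S * B) *
      fromBlocks (1 + C * R * L) (-(C * R * B)) (-(F * R * L)) (1 + F * R * B) = 1 := by
  rw [fromBlocks_multiply, ← fromBlocks_one]
  congr 1
  · have := mul_mul_eq_of_resolvent B C F L R S h C L
    simp only [Matrix.sub_mul, Matrix.mul_add, Matrix.one_mul, Matrix.mul_one, Matrix.mul_neg]
    linear_combination (norm := abel) this
  · have := mul_mul_eq_of_resolvent B C F L R S h C B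
    simp only [Matrix.sub_mul, Matrix.mul_add, Matrix.one_mul, Matrix.mul_one, Matrix.mul_neg]
    linear_combination (norm := abel) -this
  · have := mul_mul_eq_of_resolvent B C F L R S h F L
    simp only [Matrix.sub_mul, Matrix.mul_add, Matrix.one_mul, Matrix.mul_one, Matrix.mul_neg,
      neg_neg]
    linear_combination (norm := abel) -this
  · have := mul_mul_eq_of_resolvent B C F L R S h F B
    simp only [Matrix.sub_mul, Matrix.mul_add, Matrix.one_mul, Matrix.mul_one, Matrix.mul_neg,
      neg_neg]
    linear_combination (norm := abel) this

/-- Bézout identities for the doubly coprime factorization of the plant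
`G(z) = C (zI - A)⁻¹ B` built from stabilizing gains `F` and `L`. -/
theorem dcf_bezout_identities (n m p : ℕ)
    (A : Matrix (Fin n) (Fin n) ℝ) (B : Matrix (Fin n) (Fin m) ℝ)
    (C : Matrix (Fin p) (Fin n) ℝ) (F : Matrix (Fin m) (Fin n) ℝ)
    (L : Matrix (Fin n) (Fin p) ℝ) :
    let z : RatFunc ℝ := RatFunc.X
    let A' := A.map (algebraMap ℝ (RatFunc ℝ))
    let B' := B.map (algebraMap ℝ (RatFunc ℝ))
    let C' := C.map (algebraMap ℝ (RatFunc ℝ))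
    let F' := F.map (algebraMap ℝ (RatFunc ℝ))
    let L' := L.map (algebraMap ℝ (RatFunc ℝ))
    let AF := A' + B' * F'
    let AL := A' - L' * C'
    let RF := (z • (1 : Matrix (Fin n) (Fin n) (RatFunc ℝ)) - AF)⁻¹
    let RL := (z • (1 : Matrix (Fin n) (Fin n) (RatFunc ℝ)) - AL)⁻¹
    let M := (1 : Matrix (Fin m) (Fin m) (RatFunc ℝ)) + F' * RF * B'
    let N := C' * RF * B'
    let Mt := (1 : Matrix (Fin p) (Fin p) (RatFunc ℝ)) - C' * RL * L'
    let Nt := C' * RL * B'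
    let X := -(F' * RL * L')
    let Y := (1 : Matrix (Fin m) (Fin m) (RatFunc ℝ)) - F' * RL * B'
    let Xt := -(F' * RF * L')
    let Yt := (1 : Matrix (Fin p) (Fin p) (RatFunc ℝ)) + C' * RF * L'
    Matrix.fromBlocks Mt Nt (-X) Y * Matrix.fromBlocks Yt (-N) Xt M = 1 ∧
      Matrix.fromBlocks Yt (-N) Xt M * Matrix.fromBlocks Mt Nt (-X) Y = 1 := by
  intro z A' B' C' F' L' AF AL RF RL M N Mt Nt X Y Xt Yt
  have hF : IsUnit (z • (1 : Matrix (Fin n) (Fin n) (RatFunc ℝ)) - AF) := by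
    have := isUnit_ratFunc_X_smul_one_sub_map (A + B * F)
    rwa [Matrix.map_add _ (map_add _), Matrix.map_mul] at this
  have hL : IsUnit (z • (1 : Matrix (Fin n) (Fin n) (RatFunc ℝ)) - AL) := by
    have := isUnit_ratFunc_X_smul_one_sub_map (A - L * C)
    rwa [Matrix.map_sub _ (map_sub _), Matrix.map_mul] at this
  have hres : RF - RL = RL * (B' * F' + L' * C') * RF := by
    have hdiff : B' * F' + L' * C' = (z • (1 : Matrix (Fin n) (Fin n) (RatFunc ℝ)) - AL) -
        (z • (1 : Matrix (Fin n) (Fin n) (RatFunc ℝ)) - AF) := by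
      simp only [AF, AL]
      abel
    rw [hdiff, Matrix.mul_sub, Matrix.sub_mul,
      Matrix.nonsing_inv_mul _ ((Matrix.isUnit_iff_isUnit_det _).mp hL), Matrix.one_mul,
      Matrix.mul_assoc, Matrix.mul_nonsing_inv _ ((Matrix.isUnit_iff_isUnit_det _).mp hF),
      Matrix.mul_one]
  have h := fromBlocks_mul_fromBlocks_eq_one_of_resolvent B' C' F' L' RF RL hres
  exact ⟨h, mul_eq_one_comm.mp h⟩
end
end

section
/- The push-through identity holds: the matrix M := 1 + F*(z•1 − A − B*F)⁻¹*B is invertible over K = RatFunc ℝ, and (z•1 − A − B*F)⁻¹ * B * (1 + F*(z•1 − A − B*F)⁻¹*B)⁻¹ = (z•1 − A)⁻¹ * B. Equivalently, with P := (z•1 − A_F)⁻¹*B and A_F := A + B*F, one has P * M⁻¹ = (z•1 − A)⁻¹ * B. -/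
open Matrix

set_option synthInstance.maxHeartbeats 400000

noncomputable section

/-- If `D` and `D + B F` are invertible, then so is `1 + F D⁻¹ B`. -/
theorem isUnit_one_add_mul_inv_mul {R ι κ : Type*} [CommRing R] [Fintype ι] [DecidableEq ι]
    [Fintype κ] [DecidableEq κ] {D : Matrix ι ι R} {B : Matrix ι κ R} {F : Matrix κ ι R}
    (hD : IsUnit D) (hG : IsUnit (D + B * F)) : IsUnit (1 + F * (D⁻¹ * B)) := by
  rw [isUnit_iff_isUnit_det, det_one_add_mul_comm, ← isUnit_iff_isUnit_det]
  have h : 1 + D⁻¹ * B * F = D⁻¹ * (D + B * F) := by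
    rw [mul_add, nonsing_inv_mul _ ((isUnit_iff_isUnit_det _).1 hD), Matrix.mul_assoc]
  rw [h]
  exact (isUnit_nonsing_inv_iff.2 hD).mul hG

/-- The push-through identity for matrices over a commutative ring. -/
theorem inv_mul_mul_inv_one_add_mul_inv_mul {R ι κ : Type*} [CommRing R] [Fintype ι]
    [DecidableEq ι] [Fintype κ] [DecidableEq κ] {D : Matrix ι ι R} {B : Matrix ι κ R}
    {F : Matrix κ ι R} (hD : IsUnit D) (hG : IsUnit (D + B * F)) :
    D⁻¹ * B * (1 + F * (D⁻¹ * B))⁻¹ = (D + B * F)⁻¹ * B := by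
  have hM := (isUnit_iff_isUnit_det _).1 (isUnit_one_add_mul_inv_mul hD hG)
  rw [isUnit_iff_isUnit_det] at hD hG
  have h : (D + B * F) * (D⁻¹ * B) = B * (1 + F * (D⁻¹ * B)) := by
    rw [Matrix.add_mul, Matrix.mul_add, mul_nonsing_inv_cancel_left _ _ hD, Matrix.mul_one,
      Matrix.mul_assoc]
  rw [← nonsing_inv_mul_cancel_left _ (D⁻¹ * B * (1 + F * (D⁻¹ * B))⁻¹) hG,
    ← Matrix.mul_assoc (D + B * F), h, mul_nonsing_inv_cancel_right _ _ hM]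

/-- The matrix `X • 1 - A` is invertible over the field of rational functions. -/
theorem isUnit_smul_one_sub_map_algebraMap {K ι : Type*} [Field K] [Fintype ι] [DecidableEq ι]
    (A : Matrix ι ι K) :
    IsUnit ((RatFunc.X : RatFunc K) • (1 : Matrix ι ι (RatFunc K)) -
      A.map (algebraMap K (RatFunc K))) := by
  have h : (RatFunc.X : RatFunc K) • (1 : Matrix ι ι (RatFunc K)) -
      A.map (algebraMap K (RatFunc K)) =
        (algebraMap (Polynomial K) (RatFunc K)).mapMatrix (charmatrix A) := by
    ext i j
    by_cases hij : i = j
    · subst hij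
      simp [charmatrix_apply_eq]
    · simp [hij]
  rw [isUnit_iff_isUnit_det, h, ← RingHom.map_det, isUnit_iff_ne_zero]
  exact RatFunc.algebraMap_ne_zero (charpoly_monic A).ne_zero

/-- Push-through identity: `M = 1 + F (zI - A - BF)⁻¹ B` is invertible and
`(zI - A - BF)⁻¹ B M⁻¹ = (zI - A)⁻¹ B`, i.e. `P * M⁻¹ = (zI - A)⁻¹ B`. -/
theorem push_through_identity (n m : ℕ)
    (A : Matrix (Fin n) (Fin n) ℝ) (B : Matrix (Fin n) (Fin m) ℝ)
    (F : Matrix (Fin m) (Fin n) ℝ) :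
    let z : RatFunc ℝ := RatFunc.X
    let A' := A.map (algebraMap ℝ (RatFunc ℝ))
    let B' := B.map (algebraMap ℝ (RatFunc ℝ))
    let F' := F.map (algebraMap ℝ (RatFunc ℝ))
    let AF := A' + B' * F'
    let P := (z • (1 : Matrix (Fin n) (Fin n) (RatFunc ℝ)) - AF)⁻¹ * B'
    let M := (1 : Matrix (Fin m) (Fin m) (RatFunc ℝ)) + F' * P
    IsUnit M ∧ P * M⁻¹ = (z • (1 : Matrix (Fin n) (Fin n) (RatFunc ℝ)) - A')⁻¹ * B' := by
  intro z A' B' F' AF P M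
  have hG := isUnit_smul_one_sub_map_algebraMap A
  have hAF : AF = (A + B * F).map (algebraMap ℝ (RatFunc ℝ)) := by
    simp only [AF, A', B', F', Matrix.map_add _ (map_add (algebraMap ℝ (RatFunc ℝ))),
      Matrix.map_mul]
  have hD : IsUnit (z • (1 : Matrix (Fin n) (Fin n) (RatFunc ℝ)) - AF) :=
    hAF ▸ isUnit_smul_one_sub_map_algebraMap (A + B * F)
  have h : z • (1 : Matrix (Fin n) (Fin n) (RatFunc ℝ)) - AF + B' * F' = z • 1 - A' := by
    simp only [AF]
    abel
  refine ⟨isUnit_one_add_mul_inv_mul hD (h ▸ hG), ?_⟩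
  have key := inv_mul_mul_inv_one_add_mul_inv_mul hD (h ▸ hG)
  rwa [h] at key
end
end

section
/- For every Youla parameter Q : Matrix (Fin m) (Fin p) R, the shifted factors X_Q, Y_Q, X̃_Q, Ỹ_Q again satisfy the Bézout identities: Matrix.fromBlocks M̃ Ñ (−X_Q) Y_Q * Matrix.fromBlocks Ỹ_Q (−N) X̃_Q M = 1 and Matrix.fromBlocks Ỹ_Q (−N) X̃_Q M * Matrix.fromBlocks M̃ Ñ (−X_Q) Y_Q = 1. -/
open Matrix

noncomputable section

/-- The Youla-shifted factors again satisfy the Bézout identities. -/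
theorem youla_shifted_bezout {R : Type*} [CommRing R] (n m p : ℕ)
    (M : Matrix (Fin m) (Fin m) R) (N : Matrix (Fin p) (Fin m) R)
    (Mt : Matrix (Fin p) (Fin p) R) (Nt : Matrix (Fin p) (Fin m) R)
    (X : Matrix (Fin m) (Fin p) R) (Y : Matrix (Fin m) (Fin m) R)
    (Xt : Matrix (Fin m) (Fin p) R) (Yt : Matrix (Fin p) (Fin p) R)
    (hBezout₁ : Matrix.fromBlocks Mt Nt (-X) Y * Matrix.fromBlocks Yt (-N) Xt M = 1)
    (hBezout₂ : Matrix.fromBlocks Yt (-N) Xt M * Matrix.fromBlocks Mt Nt (-X) Y = 1)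
    (Q : Matrix (Fin m) (Fin p) R) :
    Matrix.fromBlocks Mt Nt (-(X + Q * Mt)) (Y - Q * Nt) *
        Matrix.fromBlocks (Yt - N * Q) (-N) (Xt + M * Q) M = 1 ∧
      Matrix.fromBlocks (Yt - N * Q) (-N) (Xt + M * Q) M *
        Matrix.fromBlocks Mt Nt (-(X + Q * Mt)) (Y - Q * Nt) = 1 := by
  have hA : fromBlocks Mt Nt (-(X + Q * Mt)) (Y - Q * Nt) =
      fromBlocks 1 0 (-Q) 1 * fromBlocks Mt Nt (-X) Y := by
    simp [fromBlocks_multiply, sub_eq_add_neg, add_comm]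
  have hB : fromBlocks (Yt - N * Q) (-N) (Xt + M * Q) M =
      fromBlocks Yt (-N) Xt M * fromBlocks 1 0 Q 1 := by
    simp [fromBlocks_multiply, sub_eq_add_neg]
  have hAB : fromBlocks Mt Nt (-(X + Q * Mt)) (Y - Q * Nt) *
      fromBlocks (Yt - N * Q) (-N) (Xt + M * Q) M = 1 := by
    rw [hA, hB, Matrix.mul_assoc, ← Matrix.mul_assoc (fromBlocks Mt Nt (-X) Y), hBezout₁,
      Matrix.one_mul]
    simp [fromBlocks_multiply]
  exact ⟨hAB, mul_eq_one_comm.mp hAB⟩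
end
end

section
/- For every Youla parameter Q : Matrix (Fin m) (Fin p) R one has X_Q * Ỹ_Q = Y_Q * X̃_Q. Consequently, if R is a field and Y_Q and Ỹ_Q are invertible, then Y_Q⁻¹ * X_Q = X̃_Q * Ỹ_Q⁻¹, so the Youla controller K_Q = Y_Q⁻¹X_Q = X̃_QỸ_Q⁻¹ is well defined. -/
open Matrix

noncomputable section

/-- `X_Q * Ỹ_Q = Y_Q * X̃_Q`; consequently, over a field, if `Y_Q` and `Ỹ_Q` are
invertible then `Y_Q⁻¹ * X_Q = X̃_Q * Ỹ_Q⁻¹`, so the Youla controller is well defined. -/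
theorem youla_controller_well_defined {R : Type*} [CommRing R] (n m p : ℕ)
    (M : Matrix (Fin m) (Fin m) R) (N : Matrix (Fin p) (Fin m) R)
    (Mt : Matrix (Fin p) (Fin p) R) (Nt : Matrix (Fin p) (Fin m) R)
    (X : Matrix (Fin m) (Fin p) R) (Y : Matrix (Fin m) (Fin m) R)
    (Xt : Matrix (Fin m) (Fin p) R) (Yt : Matrix (Fin p) (Fin p) R)
    (hBezout₁ : Matrix.fromBlocks Mt Nt (-X) Y * Matrix.fromBlocks Yt (-N) Xt M = 1)
    (hBezout₂ : Matrix.fromBlocks Yt (-N) Xt M * Matrix.fromBlocks Mt Nt (-X) Y = 1)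
    (Q : Matrix (Fin m) (Fin p) R) :
    (X + Q * Mt) * (Yt - N * Q) = (Y - Q * Nt) * (Xt + M * Q) ∧
      (IsField R → IsUnit (Y - Q * Nt) → IsUnit (Yt - N * Q) →
        (Y - Q * Nt)⁻¹ * (X + Q * Mt) = (Xt + M * Q) * (Yt - N * Q)⁻¹) := by
  rw [Matrix.fromBlocks_multiply, ← Matrix.fromBlocks_one, Matrix.fromBlocks_inj] at hBezout₁
  obtain ⟨h₁₁, h₁₂, h₂₁, h₂₂⟩ := hBezout₁
  have key : (X + Q * Mt) * (Yt - N * Q) = (Y - Q * Nt) * (Xt + M * Q) := by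
    rw [← sub_eq_zero]
    calc (X + Q * Mt) * (Yt - N * Q) - (Y - Q * Nt) * (Xt + M * Q)
        = Q * (Mt * Yt + Nt * Xt) - (-X * -N + Y * M) * Q
            - (-X * Yt + Y * Xt) + Q * (Mt * -N + Nt * M) * Q := by
          simp only [Matrix.add_mul, Matrix.mul_add, Matrix.sub_mul, Matrix.mul_sub,
            Matrix.neg_mul, Matrix.mul_neg, Matrix.mul_assoc]
          abel
      _ = 0 := by rw [h₁₁, h₁₂, h₂₁, h₂₂]; simp
  refine ⟨key, fun _ hY hYt => ?_⟩
  rw [Matrix.isUnit_iff_isUnit_det] at hY hYt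
  calc (Y - Q * Nt)⁻¹ * (X + Q * Mt)
      = (Y - Q * Nt)⁻¹ * ((X + Q * Mt) * (Yt - N * Q)) * (Yt - N * Q)⁻¹ := by
        rw [← Matrix.mul_assoc, Matrix.mul_nonsing_inv_cancel_right _ _ hYt]
    _ = (Xt + M * Q) * (Yt - N * Q)⁻¹ := by
        rw [key, Matrix.nonsing_inv_mul_cancel_left _ _ hY]
end
end

section
/- Every solution of the observer equation arises from the affine parameterization: if Ψu : Matrix (Fin n) (Fin m) R and Ψy : Matrix (Fin n) (Fin p) R satisfy Ψu*M + Ψy*N = P, then there exists S : Matrix (Fin n) (Fin p) R such that Ψu = P*Y + S*Ñ and Ψy = P*X − S*M̃; indeed the explicit choice S := (Ψu − P*Y)*X̃ − (Ψy − P*X)*Ỹ works. -/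
open Matrix

noncomputable section

/-- Every solution of the observer equation arises from the affine parameterization,
with the explicit parameter `S = (Ψu - P*Y)*X̃ - (Ψy - P*X)*Ỹ`. -/
theorem observer_equation_affine_parameterization {R : Type*} [CommRing R] (n m p : ℕ)
    (M : Matrix (Fin m) (Fin m) R) (N : Matrix (Fin p) (Fin m) R)
    (Mt : Matrix (Fin p) (Fin p) R) (Nt : Matrix (Fin p) (Fin m) R)
    (X : Matrix (Fin m) (Fin p) R) (Y : Matrix (Fin m) (Fin m) R)
    (Xt : Matrix (Fin m) (Fin p) R) (Yt : Matrix (Fin p) (Fin p) R)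
    (hBezout₁ : Matrix.fromBlocks Mt Nt (-X) Y * Matrix.fromBlocks Yt (-N) Xt M = 1)
    (hBezout₂ : Matrix.fromBlocks Yt (-N) Xt M * Matrix.fromBlocks Mt Nt (-X) Y = 1)
    (P : Matrix (Fin n) (Fin m) R)
    (Ψu : Matrix (Fin n) (Fin m) R) (Ψy : Matrix (Fin n) (Fin p) R)
    (hobs : Ψu * M + Ψy * N = P) :
    (∃ S : Matrix (Fin n) (Fin p) R, Ψu = P * Y + S * Nt ∧ Ψy = P * X - S * Mt) ∧
      (Ψu = P * Y + ((Ψu - P * Y) * Xt - (Ψy - P * X) * Yt) * Nt ∧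
        Ψy = P * X - ((Ψu - P * Y) * Xt - (Ψy - P * X) * Yt) * Mt) := by
  rw [fromBlocks_multiply, ← fromBlocks_one, fromBlocks_inj] at hBezout₁ hBezout₂
  obtain ⟨-, -, hXY, -⟩ := hBezout₁
  obtain ⟨hYM, hYN, hXM, hXN⟩ := hBezout₂
  have hXY' : Y * Xt = X * Yt := by
    rwa [Matrix.neg_mul, neg_add_eq_zero, eq_comm] at hXY
  have hYM' : Yt * Mt = 1 - N * X := by
    rw [← hYM]; simp
  have hYN' : Yt * Nt = N * Y := by
    rwa [Matrix.neg_mul, ← sub_eq_add_neg, sub_eq_zero] at hYN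
  have hXM' : Xt * Mt = M * X := by
    rwa [Matrix.mul_neg, ← sub_eq_add_neg, sub_eq_zero] at hXM
  have hXN' : Xt * Nt = 1 - M * Y := by
    rw [← hXN]; simp
  have hS : (Ψu - P * Y) * Xt - (Ψy - P * X) * Yt = Ψu * Xt - Ψy * Yt := by
    simp only [Matrix.sub_mul, Matrix.mul_assoc, hXY']
    abel
  have hu : Ψu = P * Y + ((Ψu - P * Y) * Xt - (Ψy - P * X) * Yt) * Nt := by
    rw [hS, ← hobs]
    simp only [Matrix.sub_mul, Matrix.add_mul, Matrix.mul_assoc, hXN', hYN', Matrix.mul_sub,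
      Matrix.mul_one]
    abel
  have hy : Ψy = P * X - ((Ψu - P * Y) * Xt - (Ψy - P * X) * Yt) * Mt := by
    rw [hS, ← hobs]
    simp only [Matrix.sub_mul, Matrix.add_mul, Matrix.mul_assoc, hXM', hYM', Matrix.mul_sub,
      Matrix.mul_one]
    abel
  exact ⟨⟨_, hu, hy⟩, hu, hy⟩
end
end

section
/- Assume R is a field and M and M̃ are invertible. For any P : Matrix (Fin n) (Fin m) R and S : Matrix (Fin n) (Fin p) R, the filters Ψu_S := P*Y + S*Ñ and Ψy_S := P*X − S*M̃ satisfy Ψu_S + Ψy_S * (M̃⁻¹ * Ñ) = P * M⁻¹. (Interpretation: for the plant G = M̃⁻¹Ñ = NM⁻¹ in closed loop, the transfer matrix from the input disturbance w to the estimation error x − x̂ equals Ψu_S, and the transfer from the measurement noise ν equals −Ψy_S.) -/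
open Matrix

noncomputable section

/-- The estimator filters satisfy `Ψu_S + Ψy_S * (M̃⁻¹ * Ñ) = P * M⁻¹`
(closed-loop maps from disturbances/noise to the estimation error). -/
theorem estimator_filters_closed_loop {R : Type*} [Field R] (n m p : ℕ)
    (M : Matrix (Fin m) (Fin m) R) (N : Matrix (Fin p) (Fin m) R)
    (Mt : Matrix (Fin p) (Fin p) R) (Nt : Matrix (Fin p) (Fin m) R)
    (X : Matrix (Fin m) (Fin p) R) (Y : Matrix (Fin m) (Fin m) R)
    (Xt : Matrix (Fin m) (Fin p) R) (Yt : Matrix (Fin p) (Fin p) R)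
    (hBezout₁ : Matrix.fromBlocks Mt Nt (-X) Y * Matrix.fromBlocks Yt (-N) Xt M = 1)
    (hBezout₂ : Matrix.fromBlocks Yt (-N) Xt M * Matrix.fromBlocks Mt Nt (-X) Y = 1)
    (hM : IsUnit M) (hMt : IsUnit Mt)
    (P : Matrix (Fin n) (Fin m) R) (S : Matrix (Fin n) (Fin p) R) :
    (P * Y + S * Nt) + (P * X - S * Mt) * (Mt⁻¹ * Nt) = P * M⁻¹ := by
  rw [Matrix.fromBlocks_multiply, ← Matrix.fromBlocks_one, Matrix.fromBlocks_inj] at hBezout₁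
  obtain ⟨-, hNt, -, hXY⟩ := hBezout₁
  have hM' : IsUnit M.det := (Matrix.isUnit_iff_isUnit_det M).mp hM
  have hMt' : IsUnit Mt.det := (Matrix.isUnit_iff_isUnit_det Mt).mp hMt
  have hNtM : Nt * M = Mt * N := by
    rw [Matrix.mul_neg, neg_add_eq_zero] at hNt
    exact hNt.symm
  have hS : S * Mt * (Mt⁻¹ * Nt) = S * Nt := by
    rw [Matrix.mul_assoc, Matrix.mul_nonsing_inv_cancel_left _ _ hMt']
  have hG : Mt⁻¹ * Nt = N * M⁻¹ := by
    rw [← Matrix.mul_nonsing_inv_cancel_right M Nt hM', hNtM, Matrix.mul_assoc,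
      Matrix.nonsing_inv_mul_cancel_left _ _ hMt']
  have hY : Y + X * (N * M⁻¹) = M⁻¹ := by
    rw [Matrix.neg_mul, Matrix.mul_neg, neg_neg] at hXY
    calc Y + X * (N * M⁻¹) = (X * N + Y * M) * M⁻¹ := by
          rw [Matrix.add_mul, Matrix.mul_nonsing_inv_cancel_right _ _ hM', Matrix.mul_assoc,
            add_comm]
      _ = M⁻¹ := by rw [hXY, Matrix.one_mul]
  calc (P * Y + S * Nt) + (P * X - S * Mt) * (Mt⁻¹ * Nt)
      = P * Y + P * X * (Mt⁻¹ * Nt) := by rw [Matrix.sub_mul, hS]; abel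
    _ = P * M⁻¹ := by rw [hG, Matrix.mul_assoc, ← Matrix.mul_add, hY]
end
end

section
/- Suppose F : Matrix (Fin m) (Fin n) R and P : Matrix (Fin n) (Fin m) R satisfy F*P = M − 1, and S : Matrix (Fin n) (Fin p) R and Q : Matrix (Fin m) (Fin p) R satisfy F*S = Q + X̃. Then 1 − F*(P*Y + S*Ñ) = Y − Q*Ñ and F*(P*X − S*M̃) = −(X + Q*M̃). Consequently, if R is a field and Y_Q = Y − Q*Ñ is invertible, then the output-feedback controller realized by u = F·x̂ with the estimator x̂ = (P*Y + S*Ñ)·u + (P*X − S*M̃)·y equals (1 − F*(P*Y + S*Ñ))⁻¹ * (F*(P*X − S*M̃)) = −Y_Q⁻¹ * X_Q, i.e. it is the Youla controller associated with the parameter Q. -/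
open Matrix

noncomputable section

/-- The fixed state-feedback gain `F` in tandem with the `S`-parameterized estimator
realizes the Youla controller associated with `Q`, where `F*S = Q + X̃`. -/
theorem state_feedback_estimator_realizes_youla {R : Type*} [CommRing R] (n m p : ℕ)
    (M : Matrix (Fin m) (Fin m) R) (N : Matrix (Fin p) (Fin m) R)
    (Mt : Matrix (Fin p) (Fin p) R) (Nt : Matrix (Fin p) (Fin m) R)
    (X : Matrix (Fin m) (Fin p) R) (Y : Matrix (Fin m) (Fin m) R)
    (Xt : Matrix (Fin m) (Fin p) R) (Yt : Matrix (Fin p) (Fin p) R)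
    (hBezout₁ : Matrix.fromBlocks Mt Nt (-X) Y * Matrix.fromBlocks Yt (-N) Xt M = 1)
    (hBezout₂ : Matrix.fromBlocks Yt (-N) Xt M * Matrix.fromBlocks Mt Nt (-X) Y = 1)
    (F : Matrix (Fin m) (Fin n) R) (P : Matrix (Fin n) (Fin m) R)
    (S : Matrix (Fin n) (Fin p) R) (Q : Matrix (Fin m) (Fin p) R)
    (hFP : F * P = M - 1) (hFS : F * S = Q + Xt) :
    (1 - F * (P * Y + S * Nt) = Y - Q * Nt) ∧
      (F * (P * X - S * Mt) = -(X + Q * Mt)) ∧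
      (IsField R → IsUnit (Y - Q * Nt) →
        (1 - F * (P * Y + S * Nt))⁻¹ * (F * (P * X - S * Mt)) =
          -((Y - Q * Nt)⁻¹ * (X + Q * Mt))) := by
  rw [fromBlocks_multiply, ← fromBlocks_one, fromBlocks_inj] at hBezout₂
  obtain ⟨-, -, h₁, h₂⟩ := hBezout₂
  have hY : 1 - F * (P * Y + S * Nt) = Y - Q * Nt := by
    rw [Matrix.mul_add, ← Matrix.mul_assoc, ← Matrix.mul_assoc, hFP, hFS,
      Matrix.sub_mul, Matrix.add_mul, Matrix.one_mul, ← h₂]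
    abel
  have hX : F * (P * X - S * Mt) = -(X + Q * Mt) := by
    rw [Matrix.mul_neg, ← sub_eq_add_neg, sub_eq_zero] at h₁
    rw [Matrix.mul_sub, ← Matrix.mul_assoc, ← Matrix.mul_assoc, hFP, hFS,
      Matrix.sub_mul, Matrix.add_mul, Matrix.one_mul, h₁]
    abel
  exact ⟨hY, hX, fun _ _ => by rw [hY, hX, Matrix.mul_neg]⟩
end
end

section
/- Suppose F : Matrix (Fin m) (Fin n) R and P : Matrix (Fin n) (Fin m) R satisfy F*P = M − 1, and S : Matrix (Fin n) (Fin p) R and Q : Matrix (Fin m) (Fin p) R satisfy F*S = Q + X̃. Then the transformed estimation-error maps satisfy F*(P*Y_Q + S*Ñ) = 1 − Y_Q + (1 − M)*Q*Ñ and −F*(P*X_Q − S*M̃) = X_Q + (1 − M)*Q*M̃, where X_Q := X + Q*M̃ and Y_Q := Y − Q*Ñ. (These two expressions are exactly the entries of the objective of the optimal observer evaluation problem, i.e. F·T^{(x−x̂)w} and F·T^{(x−x̂)ν}.) -/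
open Matrix

noncomputable section

/-- Transformed estimation-error maps: `F·T^{(x-x̂)w} = 1 - Y_Q + (1-M)·Q·Ñ` and
`F·T^{(x-x̂)ν} = X_Q + (1-M)·Q·M̃`. -/
theorem transformed_error_maps {R : Type*} [CommRing R] (n m p : ℕ)
    (M : Matrix (Fin m) (Fin m) R) (N : Matrix (Fin p) (Fin m) R)
    (Mt : Matrix (Fin p) (Fin p) R) (Nt : Matrix (Fin p) (Fin m) R)
    (X : Matrix (Fin m) (Fin p) R) (Y : Matrix (Fin m) (Fin m) R)
    (Xt : Matrix (Fin m) (Fin p) R) (Yt : Matrix (Fin p) (Fin p) R)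
    (hBezout₁ : Matrix.fromBlocks Mt Nt (-X) Y * Matrix.fromBlocks Yt (-N) Xt M = 1)
    (hBezout₂ : Matrix.fromBlocks Yt (-N) Xt M * Matrix.fromBlocks Mt Nt (-X) Y = 1)
    (F : Matrix (Fin m) (Fin n) R) (P : Matrix (Fin n) (Fin m) R)
    (S : Matrix (Fin n) (Fin p) R) (Q : Matrix (Fin m) (Fin p) R)
    (hFP : F * P = M - 1) (hFS : F * S = Q + Xt) :
    F * (P * (Y - Q * Nt) + S * Nt) = 1 - (Y - Q * Nt) + (1 - M) * Q * Nt ∧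
      -(F * (P * (X + Q * Mt) - S * Mt)) = (X + Q * Mt) + (1 - M) * Q * Mt := by
  rw [Matrix.fromBlocks_multiply, ← Matrix.fromBlocks_one, Matrix.fromBlocks_inj] at hBezout₂
  obtain ⟨-, -, hX, hY⟩ := hBezout₂
  have hXt : Xt * Mt = M * X := by
    rwa [Matrix.mul_neg, add_neg_eq_zero] at hX
  have hXtNt : Xt * Nt = 1 - M * Y := eq_sub_of_add_eq hY
  constructor
  · rw [Matrix.mul_add, ← Matrix.mul_assoc, ← Matrix.mul_assoc, hFP, hFS]
    simp only [Matrix.sub_mul, Matrix.add_mul, Matrix.mul_sub, Matrix.one_mul, Matrix.mul_assoc,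
      hXtNt]
    abel
  · rw [Matrix.mul_sub, ← Matrix.mul_assoc, ← Matrix.mul_assoc, hFP, hFS]
    simp only [Matrix.sub_mul, Matrix.add_mul, Matrix.mul_add, Matrix.one_mul, Matrix.mul_assoc,
      hXt]
    abel
end
end

section
/- Suppose additionally that the perturbed left and right factorizations are compatible, i.e. (M̃ + Δ_M̃)*(N + Δ_N) = (Ñ + Δ_Ñ)*(M + Δ_M). Then the perturbed Bézout-type product is block diagonal: Matrix.fromBlocks (M̃ + Δ_M̃) (Ñ + Δ_Ñ) (−X_Q) Y_Q * Matrix.fromBlocks Ỹ_Q (−(N + Δ_N)) X̃_Q (M + Δ_M) = Matrix.fromBlocks Φ11 0 0 Φ22, where Φ11 := (M̃ + Δ_M̃)*Ỹ_Q + (Ñ + Δ_Ñ)*X̃_Q and Φ22 := X_Q*(N + Δ_N) + Y_Q*(M + Δ_M). -/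
open Matrix

noncomputable section

/-- With compatible perturbed left/right factorizations, the perturbed Bézout-type
product is block diagonal with diagonal blocks `Φ11` and `Φ22`. -/
theorem perturbed_bezout_block_diagonal {R : Type*} [CommRing R] (n m p : ℕ)
    (M : Matrix (Fin m) (Fin m) R) (N : Matrix (Fin p) (Fin m) R)
    (Mt : Matrix (Fin p) (Fin p) R) (Nt : Matrix (Fin p) (Fin m) R)
    (X : Matrix (Fin m) (Fin p) R) (Y : Matrix (Fin m) (Fin m) R)
    (Xt : Matrix (Fin m) (Fin p) R) (Yt : Matrix (Fin p) (Fin p) R)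
    (hBezout₁ : Matrix.fromBlocks Mt Nt (-X) Y * Matrix.fromBlocks Yt (-N) Xt M = 1)
    (hBezout₂ : Matrix.fromBlocks Yt (-N) Xt M * Matrix.fromBlocks Mt Nt (-X) Y = 1)
    (Q : Matrix (Fin m) (Fin p) R)
    (ΔMt : Matrix (Fin p) (Fin p) R) (ΔNt : Matrix (Fin p) (Fin m) R)
    (ΔN : Matrix (Fin p) (Fin m) R) (ΔM : Matrix (Fin m) (Fin m) R)
    (hcompat : (Mt + ΔMt) * (N + ΔN) = (Nt + ΔNt) * (M + ΔM)) :
    Matrix.fromBlocks (Mt + ΔMt) (Nt + ΔNt) (-(X + Q * Mt)) (Y - Q * Nt) *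
        Matrix.fromBlocks (Yt - N * Q) (-(N + ΔN)) (Xt + M * Q) (M + ΔM) =
      Matrix.fromBlocks
        ((Mt + ΔMt) * (Yt - N * Q) + (Nt + ΔNt) * (Xt + M * Q)) 0 0
        ((X + Q * Mt) * (N + ΔN) + (Y - Q * Nt) * (M + ΔM)) := by
  rw [fromBlocks_multiply, ← fromBlocks_one, fromBlocks_inj] at hBezout₁
  obtain ⟨h₁₁, h₁₂, h₂₁, h₂₂⟩ := hBezout₁
  rw [fromBlocks_multiply, fromBlocks_inj]
  refine ⟨rfl, ?_, ?_, ?_⟩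
  · rw [Matrix.mul_neg, hcompat, neg_add_cancel]
  · calc
      -(X + Q * Mt) * (Yt - N * Q) + (Y - Q * Nt) * (Xt + M * Q)
          = (-X * Yt + Y * Xt) + (-X * -N + Y * M) * Q - Q * (Mt * Yt + Nt * Xt)
              - Q * (Mt * -N + Nt * M) * Q := by
        simp only [Matrix.mul_add, Matrix.add_mul, Matrix.mul_sub, Matrix.sub_mul,
          Matrix.mul_neg, Matrix.neg_mul, Matrix.mul_assoc, neg_add]
        abel
      _ = 0 := by
        rw [h₁₁, h₁₂, h₂₁, h₂₂]
        simp
  · rw [Matrix.neg_mul, Matrix.mul_neg, neg_neg]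
end
end

section
/- Assume R is a field, (M̃ + Δ_M̃)*(N + Δ_N) = (Ñ + Δ_Ñ)*(M + Δ_M), and Φ11 := (M̃ + Δ_M̃)*Ỹ_Q + (Ñ + Δ_Ñ)*X̃_Q and Φ22 := X_Q*(N + Δ_N) + Y_Q*(M + Δ_M) are invertible. Define the rescaled true-plant factors M̃pt := Φ11⁻¹*(M̃ + Δ_M̃), Ñpt := Φ11⁻¹*(Ñ + Δ_Ñ), Mpt := (M + Δ_M)*Φ22⁻¹, Npt := (N + Δ_N)*Φ22⁻¹. Then the Bézout identity is recovered with the known controller factors: Matrix.fromBlocks M̃pt Ñpt (−X_Q) Y_Q * Matrix.fromBlocks Ỹ_Q (−Npt) X̃_Q Mpt = 1. -/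
open Matrix

noncomputable section

/-- Rescaling the perturbed (true-plant) coprime factors by `Φ11⁻¹` and `Φ22⁻¹`
recovers the Bézout identity with the known controller factors. -/
theorem true_plant_bezout_recovered {R : Type*} [Field R] (n m p : ℕ)
    (M : Matrix (Fin m) (Fin m) R) (N : Matrix (Fin p) (Fin m) R)
    (Mt : Matrix (Fin p) (Fin p) R) (Nt : Matrix (Fin p) (Fin m) R)
    (X : Matrix (Fin m) (Fin p) R) (Y : Matrix (Fin m) (Fin m) R)
    (Xt : Matrix (Fin m) (Fin p) R) (Yt : Matrix (Fin p) (Fin p) R)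
    (hBezout₁ : Matrix.fromBlocks Mt Nt (-X) Y * Matrix.fromBlocks Yt (-N) Xt M = 1)
    (hBezout₂ : Matrix.fromBlocks Yt (-N) Xt M * Matrix.fromBlocks Mt Nt (-X) Y = 1)
    (Q : Matrix (Fin m) (Fin p) R)
    (ΔMt : Matrix (Fin p) (Fin p) R) (ΔNt : Matrix (Fin p) (Fin m) R)
    (ΔN : Matrix (Fin p) (Fin m) R) (ΔM : Matrix (Fin m) (Fin m) R)
    (hcompat : (Mt + ΔMt) * (N + ΔN) = (Nt + ΔNt) * (M + ΔM))
    (hΦ11 : IsUnit ((Mt + ΔMt) * (Yt - N * Q) + (Nt + ΔNt) * (Xt + M * Q)))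
    (hΦ22 : IsUnit ((X + Q * Mt) * (N + ΔN) + (Y - Q * Nt) * (M + ΔM))) :
    let Φ11 := (Mt + ΔMt) * (Yt - N * Q) + (Nt + ΔNt) * (Xt + M * Q)
    let Φ22 := (X + Q * Mt) * (N + ΔN) + (Y - Q * Nt) * (M + ΔM)
    let Mtpt := Φ11⁻¹ * (Mt + ΔMt)
    let Ntpt := Φ11⁻¹ * (Nt + ΔNt)
    let Mpt := (M + ΔM) * Φ22⁻¹
    let Npt := (N + ΔN) * Φ22⁻¹
    Matrix.fromBlocks Mtpt Ntpt (-(X + Q * Mt)) (Y - Q * Nt) *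
        Matrix.fromBlocks (Yt - N * Q) (-Npt) (Xt + M * Q) Mpt = 1 := by
  intro Φ11 Φ22 Mtpt Ntpt Mpt Npt
  rw [Matrix.fromBlocks_multiply, ← Matrix.fromBlocks_one, Matrix.fromBlocks_inj] at hBezout₁
  obtain ⟨h11, h12, h21, h22⟩ := hBezout₁
  rw [Matrix.isUnit_iff_isUnit_det] at hΦ11 hΦ22
  rw [Matrix.fromBlocks_multiply, ← Matrix.fromBlocks_one, Matrix.fromBlocks_inj]
  refine ⟨?_, ?_, ?_, ?_⟩
  · calc
      Mtpt * (Yt - N * Q) + Ntpt * (Xt + M * Q) = Φ11⁻¹ * Φ11 := by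
        rw [Matrix.mul_assoc, Matrix.mul_assoc, ← Matrix.mul_add]
      _ = 1 := Matrix.nonsing_inv_mul _ hΦ11
  · calc
      Mtpt * -Npt + Ntpt * Mpt =
          Φ11⁻¹ * ((Nt + ΔNt) * (M + ΔM) - (Mt + ΔMt) * (N + ΔN)) * Φ22⁻¹ := by
        simp only [Mtpt, Ntpt, Mpt, Npt, Matrix.mul_sub, Matrix.sub_mul, Matrix.mul_neg,
          Matrix.mul_assoc]
        abel
      _ = 0 := by rw [hcompat, sub_self, Matrix.mul_zero, Matrix.zero_mul]
  · calc
      -(X + Q * Mt) * (Yt - N * Q) + (Y - Q * Nt) * (Xt + M * Q) =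
          (-X * Yt + Y * Xt) + (-X * -N + Y * M) * Q - Q * (Mt * Yt + Nt * Xt)
            - Q * (Mt * -N + Nt * M) * Q := by
        simp only [Matrix.mul_sub, Matrix.sub_mul, Matrix.mul_add, Matrix.add_mul,
          Matrix.mul_neg, Matrix.neg_mul, Matrix.mul_assoc]
        abel
      _ = 0 := by
        rw [h11, h12, h21, h22]
        simp
  · calc
      -(X + Q * Mt) * -Npt + (Y - Q * Nt) * Mpt = Φ22 * Φ22⁻¹ := by
        simp only [Npt, Mpt]
        rw [Matrix.neg_mul, Matrix.mul_neg, neg_neg, ← Matrix.mul_assoc, ← Matrix.mul_assoc, ← Matrix.add_mul]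
      _ = 1 := Matrix.mul_nonsing_inv _ hΦ22
end
end

section
/- In the setting of the recovered true-plant Bézout identity (R a field, perturbed factorizations compatible, Φ11 and Φ22 invertible, and M̃pt, Ñpt, Mpt, Npt defined by rescaling with Φ11⁻¹, Φ22⁻¹), suppose F : Matrix (Fin m) (Fin n) R and Ppt : Matrix (Fin n) (Fin m) R satisfy F*Ppt = Mpt − 1, and S : Matrix (Fin n) (Fin p) R satisfies F*S = Q + X̃. Then the closed-loop error maps for the true plant satisfy F*(Ppt*Y_Q + S*Ñpt) = 1 − Y_Q + (1 − M)*Q*Φ11⁻¹*(Ñ + Δ_Ñ) and −F*(Ppt*X_Q − S*M̃pt) = X_Q + (1 − M)*Q*Φ11⁻¹*(M̃ + Δ_M̃). (These are the two blocks of the objective in the robust linear-observer evaluation problem with fixed state-feedback gain F.) -/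
open Matrix

noncomputable section

/-- The row `(-X_Q, Y_Q)` of Youla-shifted left factors annihilates the column `(Ỹ_Q, X̃_Q)` of
shifted right factors. -/
theorem youla_shifted_controller_factors_compatible {R m p : Type*} [CommRing R]
    [Fintype m] [Fintype p] [DecidableEq m] [DecidableEq p]
    {M : Matrix m m R} {N : Matrix p m R} {Mt : Matrix p p R} {Nt : Matrix p m R}
    {X : Matrix m p R} {Y : Matrix m m R} {Xt : Matrix m p R} {Yt : Matrix p p R}
    (h : Matrix.fromBlocks Mt Nt (-X) Y * Matrix.fromBlocks Yt (-N) Xt M = 1)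
    (Q : Matrix m p R) :
    -(X + Q * Mt) * (Yt - N * Q) + (Y - Q * Nt) * (Xt + M * Q) = 0 := by
  rw [Matrix.fromBlocks_multiply, ← Matrix.fromBlocks_one, Matrix.fromBlocks_inj] at h
  obtain ⟨h11, h12, h21, h22⟩ := h
  have key : -(X + Q * Mt) * (Yt - N * Q) + (Y - Q * Nt) * (Xt + M * Q) =
      (-X * Yt + Y * Xt) + (-X * -N + Y * M) * Q - Q * (Mt * Yt + Nt * Xt)
        - Q * (Mt * -N + Nt * M) * Q := by
    simp only [Matrix.mul_add, Matrix.add_mul, Matrix.mul_sub, Matrix.sub_mul, Matrix.neg_mul,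
      Matrix.mul_neg, Matrix.mul_assoc]
    abel
  rw [key, h11, h12, h21, h22]
  simp

/-- The Bézout identity of a perturbed plant, after normalizing the perturbed left factors
`A, B` and right factors `C, D` by the inverses of the diagonal blocks. -/
theorem normalized_bezout {R m p : Type*} [CommRing R]
    [Fintype m] [Fintype p] [DecidableEq m] [DecidableEq p]
    {A : Matrix p p R} {B : Matrix p m R} {C : Matrix p m R} {D : Matrix m m R}
    {X : Matrix m p R} {Y : Matrix m m R} {Xt : Matrix m p R} {Yt : Matrix p p R}
    (hplant : A * C = B * D) (hctrl : -X * Yt + Y * Xt = 0)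
    (hleft : IsUnit (A * Yt + B * Xt)) (hright : IsUnit (X * C + Y * D)) :
    Matrix.fromBlocks ((A * Yt + B * Xt)⁻¹ * A) ((A * Yt + B * Xt)⁻¹ * B) (-X) Y *
      Matrix.fromBlocks Yt (-(C * (X * C + Y * D)⁻¹)) Xt (D * (X * C + Y * D)⁻¹) = 1 := by
  rw [Matrix.fromBlocks_multiply, ← Matrix.fromBlocks_one, Matrix.fromBlocks_inj]
  refine ⟨?_, ?_, hctrl, ?_⟩
  · rw [Matrix.mul_assoc, Matrix.mul_assoc, ← Matrix.mul_add]
    exact Matrix.nonsing_inv_mul _ ((Matrix.isUnit_iff_isUnit_det _).1 hleft)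
  · rw [Matrix.mul_neg, Matrix.mul_assoc, Matrix.mul_assoc, ← Matrix.mul_assoc A, hplant,
      Matrix.mul_assoc B, neg_add_cancel]
  · rw [Matrix.neg_mul, Matrix.mul_neg, neg_neg, ← Matrix.mul_assoc, ← Matrix.mul_assoc, ← Matrix.add_mul]
    exact Matrix.mul_nonsing_inv _ ((Matrix.isUnit_iff_isUnit_det _).1 hright)

/-- The closed-loop error maps for the true plant: the two blocks of the objective
of the robust linear-observer evaluation problem with fixed state feedback `F`. -/
theorem robust_observer_error_maps {R : Type*} [Field R] (n m p : ℕ)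
    (M : Matrix (Fin m) (Fin m) R) (N : Matrix (Fin p) (Fin m) R)
    (Mt : Matrix (Fin p) (Fin p) R) (Nt : Matrix (Fin p) (Fin m) R)
    (X : Matrix (Fin m) (Fin p) R) (Y : Matrix (Fin m) (Fin m) R)
    (Xt : Matrix (Fin m) (Fin p) R) (Yt : Matrix (Fin p) (Fin p) R)
    (hBezout₁ : Matrix.fromBlocks Mt Nt (-X) Y * Matrix.fromBlocks Yt (-N) Xt M = 1)
    (hBezout₂ : Matrix.fromBlocks Yt (-N) Xt M * Matrix.fromBlocks Mt Nt (-X) Y = 1)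
    (Q : Matrix (Fin m) (Fin p) R)
    (ΔMt : Matrix (Fin p) (Fin p) R) (ΔNt : Matrix (Fin p) (Fin m) R)
    (ΔN : Matrix (Fin p) (Fin m) R) (ΔM : Matrix (Fin m) (Fin m) R)
    (hcompat : (Mt + ΔMt) * (N + ΔN) = (Nt + ΔNt) * (M + ΔM))
    (hΦ11 : IsUnit ((Mt + ΔMt) * (Yt - N * Q) + (Nt + ΔNt) * (Xt + M * Q)))
    (hΦ22 : IsUnit ((X + Q * Mt) * (N + ΔN) + (Y - Q * Nt) * (M + ΔM)))
    (F : Matrix (Fin m) (Fin n) R) (Ppt : Matrix (Fin n) (Fin m) R)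
    (S : Matrix (Fin n) (Fin p) R)
    (hFPpt : F * Ppt =
      (M + ΔM) * ((X + Q * Mt) * (N + ΔN) + (Y - Q * Nt) * (M + ΔM))⁻¹ - 1)
    (hFS : F * S = Q + Xt) :
    let Φ11 := (Mt + ΔMt) * (Yt - N * Q) + (Nt + ΔNt) * (Xt + M * Q)
    let Mtpt := Φ11⁻¹ * (Mt + ΔMt)
    let Ntpt := Φ11⁻¹ * (Nt + ΔNt)
    F * (Ppt * (Y - Q * Nt) + S * Ntpt) =
        1 - (Y - Q * Nt) + (1 - M) * Q * (Φ11⁻¹ * (Nt + ΔNt)) ∧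
      -(F * (Ppt * (X + Q * Mt) - S * Mtpt)) =
        (X + Q * Mt) + (1 - M) * Q * (Φ11⁻¹ * (Mt + ΔMt)) := by
  intro Φ11 Mtpt Ntpt
  have h := mul_eq_one_comm.1 <| normalized_bezout hcompat
    (youla_shifted_controller_factors_compatible hBezout₁ Q) hΦ11 hΦ22
  rw [Matrix.fromBlocks_multiply, ← Matrix.fromBlocks_one, Matrix.fromBlocks_inj] at h
  obtain ⟨-, -, h21, h22⟩ := h
  change (Xt + M * Q) * Mtpt + _ = 0 at h21
  change (Xt + M * Q) * Ntpt + _ = 1 at h22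
  change _ = 1 - (Y - Q * Nt) + (1 - M) * Q * Ntpt ∧ _ = X + Q * Mt + (1 - M) * Q * Mtpt
  constructor
  · rw [Matrix.mul_add, ← Matrix.mul_assoc, ← Matrix.mul_assoc, hFPpt, hFS,
      ← sub_eq_zero, ← sub_eq_zero.2 h22]
    simp only [Matrix.sub_mul, Matrix.add_mul, Matrix.one_mul]
    abel
  · rw [Matrix.mul_sub, ← Matrix.mul_assoc, ← Matrix.mul_assoc, hFPpt, hFS,
      ← sub_eq_zero, ← h21]
    simp only [Matrix.sub_mul, Matrix.add_mul, Matrix.one_mul, Matrix.mul_neg]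
    abel
end
end

section
/- Fractional-programming reformulation: let X be a type, C : Set X, and f g : X → ℝ with 0 ≤ f x for all x ∈ C and 0 ≤ g x < 1 for all x ∈ C. Then, taking infima in ℝ≥0∞ (so that the infimum over the empty set is ∞), ⨅ x ∈ C, ENNReal.ofReal (f x / (1 − g x)) = ⨅ δ ∈ Set.Ico (0:ℝ) 1, ⨅ x ∈ {x ∈ C | g x ≤ δ}, ENNReal.ofReal (f x / (1 − δ)). -/
open scoped ENNReal

/-- Fractional-programming reformulation: the fractional minimization splits into an
outer scalar problem over `δ ∈ [0,1)` and an inner constrained problem. -/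
theorem fractional_program_reformulation {X : Type*} (C : Set X) (f g : X → ℝ)
    (hf : ∀ x ∈ C, 0 ≤ f x) (hg0 : ∀ x ∈ C, 0 ≤ g x) (hg1 : ∀ x ∈ C, g x < 1) :
    ⨅ x ∈ C, ENNReal.ofReal (f x / (1 - g x)) =
      ⨅ δ ∈ Set.Ico (0 : ℝ) 1, ⨅ x ∈ {x ∈ C | g x ≤ δ},
        ENNReal.ofReal (f x / (1 - δ)) := by
  apply le_antisymm
  · refine le_iInf₂ fun δ hδ => le_iInf₂ fun x hx => (iInf₂_le x hx.1).trans ?_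
    have hδ1 : 0 < 1 - δ := sub_pos.mpr hδ.2
    exact ENNReal.ofReal_le_ofReal
      (div_le_div_of_nonneg_left (hf x hx.1) hδ1 (sub_le_sub_left hx.2 1))
  · exact le_iInf₂ fun x hx =>
      (iInf₂_le (g x) ⟨hg0 x hx, hg1 x hx⟩).trans (iInf₂_le x ⟨hx, le_rfl⟩)
end

section
/- Small-gain invertibility over rational functions: let p be a natural number and E : Matrix (Fin p) (Fin p) (RatFunc ℝ). Assume that for every z₀ : ℂ with ‖z₀‖ = 1: (a) for all indices i j, the denominator of E i j does not vanish at z₀, i.e. Polynomial.eval₂ (algebraMap ℝ ℂ) z₀ (RatFunc.denom (E i j)) ≠ 0, and (b) the complex matrix 1 + E(z₀) is invertible, where E(z₀) i j := RatFunc.eval (algebraMap ℝ ℂ) z₀ (E i j). Then the matrix 1 + E is invertible in Matrix (Fin p) (Fin p) (RatFunc ℝ). (In particular, hypothesis (b) holds whenever the operator norm of E(z₀) is < 1 for every z₀ on the unit circle; this is the small-gain step showing that Φ11 = I + [Δ_M̃ Δ_Ñ]·[Ỹ_Q; X̃_Q] is invertible when the uncertainty radius γ and the robustness constraint ‖[Ỹ_Q;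 X̃_Q]‖∞ ≤ 1/γ are in force.) -/
open Matrix

noncomputable section

namespace RatFunc

universe u

variable {K L : Type u} [Field K] [Field L] (f : K →+* L) (a : L)

/-- The subring of rational functions whose denominator does not vanish at `a`. -/
def regularSubring : Subring (RatFunc K) where
  carrier := {x | (denom x).eval₂ f a ≠ 0}
  zero_mem' := by simp
  one_mem' := by simp
  add_mem' {x y} hx hy hxy := by
    have := Polynomial.eval₂_eq_zero_of_dvd_of_eval₂_eq_zero f a (denom_add_dvd x y) hxy
    rw [Polynomial.eval₂_mul] at this
    exact mul_ne_zero hx hy this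
  mul_mem' {x y} hx hy hxy := by
    have := Polynomial.eval₂_eq_zero_of_dvd_of_eval₂_eq_zero f a (denom_mul_dvd x y) hxy
    rw [Polynomial.eval₂_mul] at this
    exact mul_ne_zero hx hy this
  neg_mem' {x} hx hn := by
    have hdvd : denom (-x) ∣ denom x := by
      rw [denom_dvd (denom_ne_zero x)]
      exact ⟨-num x, by rw [map_neg, neg_div, num_div_denom]⟩
    exact hx (Polynomial.eval₂_eq_zero_of_dvd_of_eval₂_eq_zero f a hdvd hn)

/-- Evaluation at `a`, as a ring homomorphism on the rational functions regular at `a`. -/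
def evalRegular : regularSubring f a →+* L where
  toFun x := eval f a (x : RatFunc K)
  map_zero' := eval_zero f a
  map_one' := eval_one f a
  map_add' x y := eval_add f a x.2 y.2
  map_mul' x y := eval_mul f a x.2 y.2

/-- If `E` has entries regular at `a`, then `1 + E` is invertible as soon as its value
at `a` is. -/
theorem isUnit_one_add_of_isUnit_one_add_eval {n : Type*} [Fintype n] [DecidableEq n]
    (E : Matrix n n (RatFunc K)) (hE : ∀ i j, (denom (E i j)).eval₂ f a ≠ 0)
    (h : IsUnit ((1 : Matrix n n L) + Matrix.of fun i j => eval f a (E i j))) :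
    IsUnit (1 + E) := by
  let A : Matrix n n (regularSubring f a) := Matrix.of fun i j => ⟨E i j, hE i j⟩
  have hA : (regularSubring f a).subtype.mapMatrix (1 + A) = 1 + E := by
    rw [map_add, map_one]
    rfl
  have hA' : (evalRegular f a).mapMatrix (1 + A) =
      1 + Matrix.of fun i j => eval f a (E i j) := by
    rw [map_add, map_one]
    rfl
  rw [Matrix.isUnit_iff_isUnit_det, isUnit_iff_ne_zero] at h ⊢
  rw [← hA', ← RingHom.map_det] at h
  rw [← hA, ← RingHom.map_det]
  intro h0
  apply h
  rw [Subtype.ext (a1 := (1 + A).det) (a2 := 0) h0, map_zero]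

end RatFunc

/-- Small-gain invertibility over rational functions: if at every point `z₀` of the
unit circle the denominators of the entries of `E` do not vanish and `1 + E(z₀)` is
an invertible complex matrix, then `1 + E` is invertible over `RatFunc ℝ`. -/
theorem small_gain_invertibility (p : ℕ) (E : Matrix (Fin p) (Fin p) (RatFunc ℝ))
    (h : ∀ z₀ : ℂ, ‖z₀‖ = 1 →
      (∀ i j, Polynomial.eval₂ (algebraMap ℝ ℂ) z₀ (RatFunc.denom (E i j)) ≠ 0) ∧
        IsUnit ((1 : Matrix (Fin p) (Fin p) ℂ) +
          Matrix.of fun i j => RatFunc.eval (algebraMap ℝ ℂ) z₀ (E i j))) :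
    IsUnit ((1 : Matrix (Fin p) (Fin p) (RatFunc ℝ)) + E) := by
  obtain ⟨hden, hunit⟩ := h 1 norm_one
  exact RatFunc.isUnit_one_add_of_isUnit_one_add_eval (algebraMap ℝ ℂ) 1 E hden hunit
end
end
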